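/- There exist absolute constants C, C' such that for every d ≥ 2, every r ≥ 1, every ε ∈ (0,1], every matrix A ∈ ℝ_{≥0}^{r×d} and every b ∈ ℝ_{≥0}^r for which the covering polyhedron P = {x ∈ ℝ^d : Ax ≥ b, x ≥ 0} is nonempty, there exists a subset X ⊆ P with |X| ≤ (C·log(d/ε)/ε)^{3r²−2r} such that (i) for every ordered norm ‖·‖_(w) on ℝ^d, inf_{x∈X} ‖x‖_(w) ≤ (1+ε)·inf_{x∈P} ‖x‖_(w), and (ii) for every symmetric monotonic norm ‖·‖_f on ℝ^d, inf_{x∈X} ‖x‖_f ≤ C'·(log d)·inf_{x∈P} ‖x‖_f. -/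

import Mathlib

/-- The vector of absolute values of the coordinates of `x`, sorted in decreasing order. -/
noncomputable def absSortDesc {d : ℕ} (x : Fin d → ℝ) : Fin d → ℝ :=
  fun k => |x (Tuple.sort (fun i => |x i|) k.rev)|

/-- The ordered norm `‖x‖_(w) = Σ_k w_k (|x|↓)_k`. -/
noncomputable def orderedNorm {d : ℕ} (w x : Fin d → ℝ) : ℝ :=
  ∑ k, w k * absSortDesc x k

/-- The top-`k` norm: the sum of the `k` largest coordinates of `|x|`. -/
noncomputable def topkNorm {d : ℕ} (k : ℕ) (x : Fin d → ℝ) : ℝ :=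
  ∑ i ∈ Finset.univ.filter (fun i : Fin d => (i : ℕ) < k), absSortDesc x i

/-- A weight vector: nonincreasing, nonnegative, nonzero. -/
def IsWeightVector {d : ℕ} (w : Fin d → ℝ) : Prop :=
  Antitone w ∧ (∀ k, 0 ≤ w k) ∧ w ≠ 0

/-- A symmetric monotonic norm on `ι → ℝ`. -/
def IsSymMonotoneNorm {ι : Type*} [Fintype ι] (f : (ι → ℝ) → ℝ) : Prop :=
  (∀ x, f x = 0 ↔ x = 0) ∧
  (∀ (a : ℝ) (x : ι → ℝ), f (a • x) = |a| * f x) ∧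
  (∀ x y : ι → ℝ, f (x + y) ≤ f x + f y) ∧
  (∀ (σ : Equiv.Perm ι) (x : ι → ℝ), f (x ∘ σ) = f x) ∧
  (∀ x y : ι → ℝ, (∀ i, 0 ≤ x i) → (∀ i, x i ≤ y i) → f x ≤ f y)

/-- Feasible load vectors of the Machine-Loads-Identical-Jobs problem. -/
def MLIJ {d : ℕ} (p : Fin d → ℝ) (n : ℕ) : Set (Fin d → ℝ) :=
  { x | ∃ m : Fin d → ℕ, (∑ i, m i) = n ∧ ∀ i, x i = (m i : ℝ) * p i }

/-- The dual of the ordered norm. -/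
noncomputable def dualOrderedNorm {d : ℕ} (w y : Fin d → ℝ) : ℝ :=
  sSup { r : ℝ | ∃ x : Fin d → ℝ, orderedNorm w x ≤ 1 ∧ r = ∑ i, y i * x i }

/-- The coordinates of `x` sorted in increasing order. -/
noncomputable def sortAsc {n : ℕ} (x : Fin n → ℝ) : Fin n → ℝ :=
  fun k => x (Tuple.sort x k)

/-- Distance vector induced by a set of open facilities. -/
noncomputable def distVec {X : Type*} [MetricSpace X] (F : Finset X) : X → ℝ :=
  fun j => sInf ((fun c => dist j c) '' (F : Set X))

/-- `x(l)`: the vector with the first `l+1` coordinates (indices `≤ l`) equal to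
`n / Σ_{j ≤ l} 1/p_j` and zero elsewhere. -/
noncomputable def vertexX {d : ℕ} (p : Fin d → ℝ) (n : ℝ) (l : Fin d) : Fin d → ℝ :=
  fun i => if i ≤ l then n / (∑ j ∈ Finset.univ.filter (fun j : Fin d => j ≤ l), 1 / p j) else 0

/-- Completion time of job `j` when job `j'` is assigned to machine `a j'` and jobs are
processed on each machine in the order induced by the priority permutation `π`. -/
noncomputable def completionTime {n d : ℕ} (p : Fin d → Fin n → ℝ)
    (a : Fin n → Fin d) (π : Equiv.Perm (Fin n)) : Fin n → ℝ :=
  fun j => ∑ j' ∈ Finset.univ.filter (fun j' : Fin n => a j' = a j ∧ π j' ≤ π j), p (a j) j'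

/-- A tour on `n` vertices starting at `v₀`: `τ 0 = v₀` and `τ` is a bijection from
`{0, …, n-1}` onto the vertex set. -/
def IsTour {V : Type*} (n : ℕ) (v₀ : V) (τ : ℕ → V) : Prop :=
  τ 0 = v₀ ∧ Set.BijOn τ (Set.Iio n) Set.univ

/-- The visit times of the vertices `τ 0, …, τ (n-1)` of a tour. -/
noncomputable def tourVisitTimes {V : Type*} [MetricSpace V] (n : ℕ) (τ : ℕ → V) : Fin n → ℝ :=
  fun i => ∑ j ∈ Finset.range (i : ℕ), dist (τ j) (τ (j + 1))

/-- Cover time of element `e` under the ordering `π` of the subsets `S 0, …, S (m-1)`: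
the position (in `{1, …, m}`) of the first subset containing `e`. -/
noncomputable def coverTime {n m : ℕ} (S : Fin m → Finset (Fin n))
    (π : Equiv.Perm (Fin m)) (e : Fin n) : ℕ :=
  1 + sInf {t : ℕ | ∃ h : t < m, e ∈ S (π ⟨t, h⟩)}

open Finset

/-- Extension of a finite sequence by zero. -/
def extendZero {d : ℕ} (w : Fin d → ℝ) (i : ℕ) : ℝ := if h : i < d then w ⟨i, h⟩ else 0

/-- The sum of the first `n` weights. -/
def prefixWeight {d : ℕ} (w : Fin d → ℝ) (n : ℕ) : ℝ := ∑ i ∈ range n, extendZero w i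

theorem extendZero_nonneg {d : ℕ} {w : Fin d → ℝ} (h0 : ∀ k, 0 ≤ w k) (i : ℕ) :
    0 ≤ extendZero w i := by
  unfold extendZero
  split_ifs
  · exact h0 _
  · exact le_rfl

theorem extendZero_antitone {d : ℕ} {w : Fin d → ℝ} (hw : Antitone w) (h0 : ∀ k, 0 ≤ w k) :
    Antitone (extendZero w) := by
  intro i j hij
  by_cases hj : j < d
  · have hi : i < d := lt_of_le_of_lt hij hj
    simp only [extendZero, hi, hj, dif_pos]
    exact hw hij
  · rw [show extendZero w j = 0 from dif_neg hj]
    exact extendZero_nonneg h0 i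

@[simp] theorem extendZero_val {d : ℕ} (w : Fin d → ℝ) (i : Fin d) :
    extendZero w i = w i := by
  simp [extendZero]

theorem prefixWeight_mono {d : ℕ} {w : Fin d → ℝ} (h0 : ∀ k, 0 ≤ w k) :
    Monotone (prefixWeight w) := fun _ _ h =>
  sum_le_sum_of_subset_of_nonneg (range_mono h) fun i _ _ => extendZero_nonneg h0 i

theorem prefixWeight_succ_val {d : ℕ} (w : Fin d → ℝ) (k : Fin d) :
    prefixWeight w (k + 1) = ∑ i ∈ Iic k, w i := by
  rw [prefixWeight, Nat.range_succ_eq_Iic, ← Fin.map_valEmbedding_Iic, sum_map]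
  simp

theorem sum_le_prefixWeight_card {d : ℕ} {w : Fin d → ℝ} (hw : Antitone w) (h0 : ∀ k, 0 ≤ w k)
    (T : Finset (Fin d)) : ∑ i ∈ T, w i ≤ prefixWeight w #T := by
  induction T using Finset.induction_on_max with
  | empty => simp [prefixWeight]
  | insert a s hs ih =>
    have ha : a ∉ s := fun h => lt_irrefl _ (hs a h)
    have hcard : #s ≤ (a : ℕ) := by
      have : s ⊆ Iio a := fun x hx => mem_Iio.2 (hs x hx)
      simpa using card_le_card this
    rw [sum_insert ha, card_insert_of_notMem ha, prefixWeight, sum_range_succ, add_comm]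
    have := extendZero_antitone hw h0 hcard
    rw [extendZero_val] at this
    exact add_le_add ih this

/-- Averages of prefixes of a nonincreasing sequence are nonincreasing. -/
theorem mul_prefixWeight_le {d : ℕ} {w : Fin d → ℝ} (hw : Antitone w) (h0 : ∀ k, 0 ≤ w k)
    {k n : ℕ} (hkn : k ≤ n) : k * prefixWeight w n ≤ n * prefixWeight w k := by
  have hlow : k * extendZero w k ≤ prefixWeight w k := by
    simpa [prefixWeight] using card_nsmul_le_sum (range k) (extendZero w) (extendZero w k)
      fun i hi => extendZero_antitone hw h0 (mem_range.1 hi).le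
  induction n, hkn using Nat.le_induction with
  | base => exact le_rfl
  | succ n hn ih =>
    have hle := extendZero_antitone hw h0 hn
    have : (k : ℝ) * extendZero w n ≤ k * extendZero w k := by gcongr
    rw [prefixWeight, sum_range_succ, ← prefixWeight]
    push_cast
    linarith

theorem prefixWeight_pos {d : ℕ} {w : Fin d → ℝ} (hw : IsWeightVector w) {n : ℕ} (hn : 0 < n) :
    0 < prefixWeight w n := by
  obtain ⟨hanti, h0, hne⟩ := hw
  obtain ⟨i, hi⟩ := Function.ne_iff.1 hne
  have hi' : 0 < w i := lt_of_le_of_ne (h0 i) (Ne.symm hi)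
  have h1 : w i ≤ extendZero w 0 := by
    rw [← extendZero_val w i]
    exact extendZero_antitone hanti h0 (Nat.zero_le _)
  calc 0 < w i := hi'
    _ ≤ extendZero w 0 := h1
    _ = prefixWeight w 1 := by simp [prefixWeight]
    _ ≤ prefixWeight w n := prefixWeight_mono h0 hn

/-- The permutation sorting the absolute values of `x` in decreasing order. -/
noncomputable def descPerm {d : ℕ} (x : Fin d → ℝ) : Equiv.Perm (Fin d) :=
  Fin.revPerm.trans (Tuple.sort fun i => |x i|)

theorem absSortDesc_eq {d : ℕ} (x : Fin d → ℝ) (k : Fin d) :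
    absSortDesc x k = |x (descPerm x k)| := rfl

theorem absSortDesc_antitone {d : ℕ} (x : Fin d → ℝ) : Antitone (absSortDesc x) := fun _ _ h =>
  Tuple.monotone_sort (fun i => |x i|) (Fin.rev_le_rev.2 h)

theorem sum_mul_abs_perm_le_orderedNorm {d : ℕ} {w : Fin d → ℝ} (hw : Antitone w)
    (x : Fin d → ℝ) (σ : Equiv.Perm (Fin d)) : ∑ k, w k * |x (σ k)| ≤ orderedNorm w x := by
  have hmono : Monovary w (absSortDesc x) := hw.monovary (absSortDesc_antitone x)
  refine le_of_eq_of_le ?_ (hmono.sum_mul_comp_perm_le_sum_mul (σ := σ.trans (descPerm x).symm))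
  simp [absSortDesc_eq]

theorem orderedNorm_add_le {d : ℕ} {w : Fin d → ℝ} (hw : IsWeightVector w) (x y : Fin d → ℝ) :
    orderedNorm w (x + y) ≤ orderedNorm w x + orderedNorm w y := by
  calc orderedNorm w (x + y)
      ≤ ∑ k, (w k * |x (descPerm (x + y) k)| + w k * |y (descPerm (x + y) k)|) := by
        refine sum_le_sum fun k _ => ?_
        rw [absSortDesc_eq, ← mul_add]
        exact mul_le_mul_of_nonneg_left (abs_add_le _ _) (hw.2.1 k)
    _ ≤ _ := by
        rw [sum_add_distrib]
        exact add_le_add (sum_mul_abs_perm_le_orderedNorm hw.1 _ _)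
          (sum_mul_abs_perm_le_orderedNorm hw.1 _ _)

theorem orderedNorm_zero {d : ℕ} (w : Fin d → ℝ) : orderedNorm w 0 = 0 := by
  simp [orderedNorm, absSortDesc]

theorem orderedNorm_sum_le {ι : Type*} {d : ℕ} {w : Fin d → ℝ} (hw : IsWeightVector w)
    (s : Finset ι) (x : ι → Fin d → ℝ) :
    orderedNorm w (∑ i ∈ s, x i) ≤ ∑ i ∈ s, orderedNorm w (x i) :=
  le_sum_of_subadditive (orderedNorm w) (orderedNorm_zero w).le (orderedNorm_add_le hw) s x

theorem orderedNorm_smul_le {d : ℕ} {w : Fin d → ℝ} (hw : IsWeightVector w) {c : ℝ} (hc : 0 ≤ c)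
    (x : Fin d → ℝ) : orderedNorm w (c • x) ≤ c * orderedNorm w x := by
  refine le_of_eq_of_le ?_ (mul_le_mul_of_nonneg_left
    (sum_mul_abs_perm_le_orderedNorm hw.1 x (descPerm (c • x))) hc)
  rw [orderedNorm, mul_sum]
  refine sum_congr rfl fun k _ => ?_
  rw [absSortDesc_eq, Pi.smul_apply, smul_eq_mul, abs_mul, abs_of_nonneg hc]
  ring

theorem orderedNorm_indicator_le {d : ℕ} {w : Fin d → ℝ} (hw : IsWeightVector w) {c : ℝ}
    (hc : 0 ≤ c) (S : Finset (Fin d)) :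
    orderedNorm w (fun j => if j ∈ S then c else 0) ≤ c * prefixWeight w #S := by
  set σ := descPerm fun j => if j ∈ S then c else 0 with hσ
  have hsum : orderedNorm w (fun j => if j ∈ S then c else 0)
      = c * ∑ k ∈ S.map σ.symm.toEmbedding, w k := by
    rw [orderedNorm, sum_map, mul_sum, ← Equiv.sum_comp σ.symm]
    rw [← sum_subset (subset_univ S)]
    · refine sum_congr rfl fun j hj => ?_
      rw [absSortDesc_eq, ← hσ]
      simp [hj, abs_of_nonneg hc, mul_comm]
    · intro j _ hj
      rw [absSortDesc_eq, ← hσ]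
      simp [hj]
  rw [hsum]
  refine mul_le_mul_of_nonneg_left ?_ hc
  simpa using sum_le_prefixWeight_card hw.1 hw.2.1 (S.map σ.symm.toEmbedding)

/-- A nonincreasing nonnegative sequence is a nonnegative combination of prefix indicators. -/
theorem exists_layers {d : ℕ} {u : Fin d → ℝ} (hu : Antitone u) (h0 : ∀ i, 0 ≤ u i) :
    ∃ c : Fin d → ℝ, (∀ k, 0 ≤ c k) ∧ ∀ i, u i = ∑ k, if i ≤ k then c k else 0 := by
  refine ⟨fun k => extendZero u k - extendZero u (k + 1),
    fun k => sub_nonneg.2 (extendZero_antitone hu h0 (Nat.le_succ _)), fun i => ?_⟩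
  have key : ∀ n, (i : ℕ) ≤ n →
      ∑ k ∈ range n, (if (i : ℕ) ≤ k then extendZero u k - extendZero u (k + 1) else 0)
        = extendZero u i - extendZero u n := by
    intro n hn
    induction n, hn using Nat.le_induction with
    | base =>
      rw [sub_self]
      exact sum_eq_zero fun k hk => if_neg (by simpa using hk)
    | succ n hn ih =>
      rw [sum_range_succ, ih, if_pos hn]
      ring
  have hd := key d i.2.le
  rw [sum_range, extendZero_val, show extendZero u d = 0 from dif_neg (lt_irrefl d), sub_zero] at hd
  rw [← hd]
  rfl

theorem sum_mul_layers {d : ℕ} {u c : Fin d → ℝ} (hc : ∀ i, u i = ∑ k, if i ≤ k then c k else 0)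
    (g : Fin d → ℝ) : ∑ i, g i * u i = ∑ k, c k * ∑ i ∈ Iic k, g i := by
  simp_rw [hc, mul_sum]
  rw [sum_comm]
  refine sum_congr rfl fun k _ => ?_
  rw [← sum_subset (subset_univ (Iic k))]
  · refine sum_congr rfl fun i hi => ?_
    rw [if_pos (mem_Iic.1 hi), mul_comm]
  · intro i _ hi
    rw [if_neg (by simpa using hi), mul_zero]

/-- Conic Carathéodory with a positive cost that does not increase. -/
theorem exists_nonneg_support_card_le {ι : Type*} [Fintype ι] [DecidableEq ι] {r : ℕ}
    (M : ι → Fin r → ℝ) {cost : ι → ℝ} (hcost : ∀ k, 0 < cost k) (c : ι → ℝ) (hc : ∀ k, 0 ≤ c k) :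
    ∃ c' : ι → ℝ, (∀ k, 0 ≤ c' k) ∧ #{k | c' k ≠ 0} ≤ r ∧
      (∑ k, c' k • M k = ∑ k, c k • M k) ∧ ∑ k, c' k * cost k ≤ ∑ k, c k * cost k := by
  induction hn : #{k | c k ≠ 0} using Nat.strong_induction_on generalizing c with
  | _ n ih =>
  by_cases hr : n ≤ r
  · exact ⟨c, hc, hn ▸ hr, rfl, le_rfl⟩
  set s : Finset ι := {k | c k ≠ 0} with hs
  have hdep : ¬ LinearIndependent ℝ fun k : s => M k := by
    intro hli
    have := hli.fintype_card_le_finrank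
    simp only [Fintype.card_coe, Module.finrank_fin_fun] at this
    omega
  obtain ⟨g, hg, i₀, hi₀⟩ := Fintype.not_linearIndependent_iff.1 hdep
  obtain ⟨μ, hμs, hμM, hμcost, i₁, hi₁⟩ : ∃ μ : ι → ℝ, (∀ k, c k = 0 → μ k = 0) ∧
      (∑ k, μ k • M k = 0) ∧ (∑ k, μ k * cost k ≤ 0) ∧ ∃ k, μ k ≠ 0 := by
    set ν : ι → ℝ := fun k => if h : k ∈ s then g ⟨k, h⟩ else 0 with hν
    have hν0 : ∀ k, c k = 0 → ν k = 0 := fun k hk => dif_neg (by simp [hs, hk])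
    have hνM : ∑ k, ν k • M k = 0 := by
      rw [← hg, ← sum_subset (subset_univ s), ← sum_coe_sort s]
      · refine sum_congr rfl fun k _ => ?_
        simp [hν]
      · intro k _ hk
        simp [hν, hk]
    have hν1 : ν i₀ ≠ 0 := by simpa [hν] using hi₀
    rcases le_total (∑ k, ν k * cost k) 0 with h | h
    · exact ⟨ν, hν0, hνM, h, i₀, hν1⟩
    · refine ⟨-ν, fun k hk => by simp [hν0 k hk], by simp [hνM], by simpa using h, i₀, by simpa⟩
  obtain ⟨i₂, hi₂⟩ : ∃ k, μ k < 0 := by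
    by_contra! hpos
    have hz := (sum_eq_zero_iff_of_nonneg fun k _ => mul_nonneg (hpos k) (hcost k).le).1
      (le_antisymm hμcost (sum_nonneg fun k _ => mul_nonneg (hpos k) (hcost k).le)) i₁ (mem_univ _)
    exact hi₁ ((mul_eq_zero.1 hz).resolve_right (hcost i₁).ne')
  obtain ⟨j, hj, hjmin⟩ := exists_min_image ({k | μ k < 0} : Finset ι) (fun k => c k / -μ k)
    ⟨i₂, by simpa using hi₂⟩
  simp only [mem_filter, mem_univ, true_and] at hj hjmin
  set t := c j / -μ j with ht
  have ht0 : 0 ≤ t := div_nonneg (hc j) (by linarith)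
  set c₁ : ι → ℝ := fun k => c k + t * μ k with hc₁
  have hc₁0 : ∀ k, 0 ≤ c₁ k := by
    intro k
    rcases lt_or_ge (μ k) 0 with h | h
    · have := (le_div_iff₀ (by linarith : 0 < -μ k)).1 (hjmin k h)
      simp only [hc₁]
      linarith
    · exact add_nonneg (hc k) (mul_nonneg ht0 h)
  have hjz : c₁ j = 0 := by
    simp only [hc₁, ht]
    field_simp [hj.ne]
    ring
  have hlt : #{k | c₁ k ≠ 0} < n := by
    rw [← hn]
    refine card_lt_card ((ssubset_iff_of_subset ?_).2 ⟨j, ?_, ?_⟩)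
    · intro k
      simp only [hs, mem_filter, mem_univ, true_and]
      intro hk hck
      exact hk (by simp [hc₁, hck, hμs k hck])
    · simp only [hs, mem_filter, mem_univ, true_and]
      exact fun h => hj.ne (hμs j h)
    · simp [hjz]
  obtain ⟨c', h1, h2, h3, h4⟩ := ih _ hlt c₁ hc₁0 rfl
  refine ⟨c', h1, h2, ?_, ?_⟩
  · rw [h3]
    simp only [hc₁, add_smul, sum_add_distrib, mul_smul, ← smul_sum, hμM, smul_zero, add_zero]
  · refine h4.trans ?_
    simp only [hc₁, add_mul, sum_add_distrib, mul_assoc, ← mul_sum]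
    nlinarith

/-- A cheapest multiple of the indicator of a set of size at most `k` meeting the demands `t`. -/
theorem exists_cheapest_indicator {d r : ℕ} (A : Fin r → Fin d → ℝ) (k : ℕ) (t : Fin r → ℝ) :
    ∃ z : Fin d → ℝ, (∀ j, 0 ≤ z j) ∧ ∀ (S : Finset (Fin d)) (c : ℝ), #S ≤ k → 0 ≤ c →
      (∀ l, t l ≤ c * ∑ j ∈ S, A l j) → (∀ l, t l ≤ ∑ j, A l j * z j) ∧
        ∀ w, IsWeightVector w → orderedNorm w z ≤ c * prefixWeight w k := by
  set Z : Set ℝ := ⋃ S : {S : Finset (Fin d) // #S ≤ k},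
    {c | 0 ≤ c ∧ ∀ l, t l ≤ c * ∑ j ∈ S.1, A l j} with hZ
  by_cases hne : Z.Nonempty
  · have hclosed : IsClosed Z := by
      refine isClosed_iUnion_of_finite fun S => ?_
      have : {c : ℝ | 0 ≤ c ∧ ∀ l, t l ≤ c * ∑ j ∈ S.1, A l j}
          = Set.Ici 0 ∩ ⋂ l, {c | t l ≤ c * ∑ j ∈ S.1, A l j} := by
        ext c
        simp
      rw [this]
      exact isClosed_Ici.inter
        (isClosed_iInter fun l => isClosed_le continuous_const (by fun_prop))
    have hbdd : BddBelow Z := by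
      refine ⟨0, fun c hc => ?_⟩
      obtain ⟨S, hS⟩ := Set.mem_iUnion.1 hc
      exact hS.1
    obtain ⟨⟨S₀, hS₀⟩, hc₀, hcov⟩ := Set.mem_iUnion.1 (hclosed.csInf_mem hne hbdd)
    refine ⟨fun j => if j ∈ S₀ then sInf Z else 0, fun j => ?_, fun S c hS hc hSc => ⟨fun l => ?_,
      fun w hw => ?_⟩⟩
    · dsimp only
      split_ifs
      · exact hc₀
      · exact le_rfl
    · refine (hcov l).trans_eq ?_
      rw [mul_sum]
      simp [mul_comm]
    · refine (orderedNorm_indicator_le hw hc₀ S₀).trans ?_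
      exact mul_le_mul (csInf_le hbdd (Set.mem_iUnion.2 ⟨⟨S, hS⟩, hc, hSc⟩))
        (prefixWeight_mono hw.2.1 hS₀) (sum_nonneg fun i _ => extendZero_nonneg hw.2.1 i) hc
  · refine ⟨0, fun _ => le_rfl, fun S c hS hc hSc => (hne ⟨c, ?_⟩).elim⟩
    exact Set.mem_iUnion.2 ⟨⟨S, hS⟩, hc, hSc⟩

/-- Every `m`-tuple of contributions covering `1` can be rounded down to values in `V` while
still covering `1 / β`. -/
def IsRounding (m : ℕ) (β : ℝ) (V : Finset ℝ) : Prop :=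
  ∀ c : Fin m → ℝ, (∀ i, 0 ≤ c i) → 1 ≤ ∑ i, c i →
    ∃ v : Fin m → ℝ, (∀ i, v i ∈ V ∧ v i ≤ c i) ∧ 1 ≤ β * ∑ i, v i

theorem isRounding_singleton {β : ℝ} (hβ : 1 ≤ β) : IsRounding 1 β {1} := by
  intro c _ hc1
  refine ⟨fun _ => 1, fun i => ⟨by simp, ?_⟩, by simpa⟩
  rw [Subsingleton.elim i 0]
  simpa using hc1

theorem IsRounding.exists_scaled {m : ℕ} {β : ℝ} {V : Finset ℝ} (h : IsRounding m β V)
    (hm : 0 < m) {b : ℝ} (hb : 0 ≤ b) {c : Fin m → ℝ} (hc : ∀ i, 0 ≤ c i) (hbc : b ≤ ∑ i, c i) :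
    ∃ v : Fin m → ℝ, (∀ i, v i ∈ V ∧ v i * b ≤ c i) ∧ b ≤ β * ∑ i, v i * b := by
  rcases hb.eq_or_lt with rfl | hb
  · obtain ⟨v, hv, -⟩ := h (fun _ => 1) (fun _ => zero_le_one) (by
      rw [sum_const, card_univ, Fintype.card_fin, nsmul_one]
      exact_mod_cast hm)
    exact ⟨v, fun i => ⟨(hv i).1, by simpa using hc i⟩, by simp⟩
  · obtain ⟨v, hv, hv1⟩ := h (fun i => c i / b) (fun i => div_nonneg (hc i) hb.le)
      (by rwa [← sum_div, one_le_div hb])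
    refine ⟨v, fun i => ⟨(hv i).1, (le_div_iff₀ hb).1 (hv i).2⟩, ?_⟩
    rw [← sum_mul, ← mul_assoc]
    exact le_mul_of_one_le_left hb.le hv1

theorem exists_pow_level {q x : ℝ} (hq : 0 ≤ q) {K : ℕ} (hx : x ≤ q ^ K) :
    ∃ j ≤ K, x ≤ q ^ j ∧ (j = 0 ∨ q ^ j ≤ q * x) := by
  classical
  have hex : ∃ j, x ≤ q ^ j := ⟨K, hx⟩
  refine ⟨Nat.find hex, Nat.find_min' hex hx, Nat.find_spec hex, ?_⟩
  rcases h : Nat.find hex with _ | j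
  · exact Or.inl rfl
  · have hj := Nat.find_min hex (h.symm ▸ Nat.lt_succ_self j : j < Nat.find hex)
    right
    rw [pow_succ']
    exact mul_le_mul_of_nonneg_left (not_le.1 hj).le hq

theorem isRounding_geometric {m d K : ℕ} {δ q β : ℝ} (hδ : 0 < δ) (hq : 1 ≤ q)
    (hd : 0 < d) (hmd : m ≤ d) (hK : d / δ ≤ q ^ K) (hβ : 1 ≤ β) (hβq : q ≤ β * (1 - δ)) :
    IsRounding m β (insert 0 ((range (K + 1)).image fun j => (q ^ j)⁻¹)) := by
  have hq0 : 0 < q := by linarith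
  have hd' : (0 : ℝ) < d := by exact_mod_cast hd
  have key : ∀ c : ℝ, 0 ≤ c → ∃ v, v ∈ insert 0 ((range (K + 1)).image fun j => (q ^ j)⁻¹) ∧
      0 ≤ v ∧ v ≤ c ∧ (v = 1 ∨ c - δ / d ≤ q * v) := by
    intro c hc
    by_cases hcd : c ≤ δ / d
    · exact ⟨0, by simp, le_rfl, hc, Or.inr (by linarith)⟩
    · push Not at hcd
      have hc0 : 0 < c := (div_pos hδ hd').trans hcd
      have hcK : c⁻¹ ≤ q ^ K := by
        refine le_trans ?_ hK
        rw [← inv_div]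
        exact inv_anti₀ (div_pos hδ hd') hcd.le
      obtain ⟨j, hjK, hj, hj'⟩ := exists_pow_level hq0.le hcK
      refine ⟨(q ^ j)⁻¹, mem_insert_of_mem (mem_image_of_mem _ (mem_range.2 (by omega))),
        by positivity, inv_le_of_inv_le₀ hc0 hj, ?_⟩
      rcases hj' with rfl | hj'
      · simp
      · right
        have h1 : c ≤ q * (q ^ j)⁻¹ := by
          rw [← div_eq_mul_inv, le_div_iff₀ (by positivity)]
          calc c * q ^ j ≤ c * (q * c⁻¹) := by gcongr
            _ = q := by field_simp
        have := div_pos hδ hd'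
        linarith
  intro c hc hc1
  choose v hvV hv0 hvc hv using fun i => key (c i) (hc i)
  refine ⟨v, fun i => ⟨hvV i, hvc i⟩, ?_⟩
  by_cases h1 : ∃ i, v i = 1
  · obtain ⟨i, hi⟩ := h1
    have : v i ≤ ∑ i, v i := single_le_sum (fun i _ => hv0 i) (mem_univ i)
    rw [hi] at this
    nlinarith
  · push Not at h1
    have hsum : ∑ i, (c i - δ / d) ≤ ∑ i, q * v i :=
      sum_le_sum fun i _ => (hv i).resolve_left (h1 i)
    rw [sum_sub_distrib, ← mul_sum, sum_const, card_univ, Fintype.card_fin, nsmul_eq_mul] at hsum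
    have hmδ : (m : ℝ) * (δ / d) ≤ δ := by
      rw [mul_div_assoc', div_le_iff₀ hd', mul_comm]
      gcongr
    have h2 : 1 - δ ≤ q * ∑ i, v i := by linarith
    have h3 : q * 1 ≤ q * (β * ∑ i, v i) := by
      calc q * 1 ≤ β * (1 - δ) := by linarith
        _ ≤ β * (q * ∑ i, v i) := by gcongr
        _ = _ := by ring
    exact le_of_mul_le_mul_left h3 hq0

theorem exists_size_level {q : ℝ} (hq : 1 ≤ q) {K n : ℕ} (hn : 1 ≤ n) (hnK : (n : ℝ) ≤ q ^ K) :
    ∃ k ∈ (range (K + 1)).image fun j => ⌊q ^ j⌋₊, n ≤ k ∧ (k : ℝ) ≤ q * n := by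
  obtain ⟨j, hjK, hj, hj'⟩ := exists_pow_level (by linarith) hnK
  refine ⟨_, mem_image_of_mem _ (mem_range.2 (Nat.lt_succ_of_le hjK)), Nat.le_floor hj,
    (Nat.floor_le (by positivity)).trans ?_⟩
  rcases hj' with rfl | hj'
  · have : (1 : ℝ) ≤ n := by exact_mod_cast hn
    rw [pow_zero]
    nlinarith
  · exact hj'

/-- The optimum over sorted points is attained by few prefix indicators. -/
theorem exists_few_indicators {d r m : ℕ} (hm : m = min d r) (A : Fin r → Fin d → ℝ)
    {w : Fin d → ℝ} (hw : IsWeightVector w) {y : Fin d → ℝ} (hy : ∀ j, 0 ≤ y j) :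
    ∃ (c : Fin m → ℝ) (S : Fin m → Finset (Fin d)) (k : Fin m → Fin d), (∀ i, 0 ≤ c i) ∧
      (∀ i, #(S i) = k i + 1) ∧ (∀ l, ∑ i, c i * ∑ j ∈ S i, A l j = ∑ j, A l j * y j) ∧
      ∑ i, c i * prefixWeight w (k i + 1) ≤ orderedNorm w y := by
  set σ := descPerm y with hσ
  obtain ⟨c, hc, hlayer⟩ := exists_layers (absSortDesc_antitone y) fun k => abs_nonneg _
  set S : Fin d → Finset (Fin d) := fun k => (Iic k).map σ.toEmbedding with hS
  have hA : ∀ l, ∑ k, c k * ∑ j ∈ S k, A l j = ∑ j, A l j * y j := by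
    intro l
    rw [← Equiv.sum_comp σ fun j => A l j * y j]
    simp only [hS, sum_map, Equiv.coe_toEmbedding]
    rw [← sum_mul_layers hlayer fun i => A l (σ i)]
    refine sum_congr rfl fun i _ => ?_
    rw [absSortDesc_eq, abs_of_nonneg (hy _)]
  have hcost : ∑ k, c k * prefixWeight w (k + 1) = orderedNorm w y := by
    simp_rw [prefixWeight_succ_val]
    exact (sum_mul_layers hlayer w).symm
  obtain ⟨c', hc', hsupp, hM, hcost'⟩ := exists_nonneg_support_card_le
    (fun k l => ∑ j ∈ S k, A l j) (fun k : Fin d => prefixWeight_pos hw (Nat.succ_pos k)) c hc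
  obtain ⟨T, hT, hTm⟩ : ∃ T : Finset (Fin d), ({k | c' k ≠ 0} : Finset (Fin d)) ⊆ T ∧ #T = m := by
    have h1 : #({k | c' k ≠ 0} : Finset (Fin d)) ≤ d := by
      simpa using card_le_univ ({k | c' k ≠ 0} : Finset (Fin d))
    exact exists_superset_card_eq (hm ▸ le_min h1 hsupp) (by simp [hm])
  have hsum : ∀ g : Fin d → ℝ, ∑ i, c' (T.orderEmbOfFin hTm i) * g (T.orderEmbOfFin hTm i)
      = ∑ k, c' k * g k := by
    intro g
    rw [← sum_subset (subset_univ T)]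
    · conv_rhs => rw [← map_orderEmbOfFin_univ T hTm, sum_map]
      rfl
    · intro k _ hk
      have : c' k = 0 := by
        by_contra h
        exact hk (hT (by simpa using h))
      rw [this, zero_mul]
  refine ⟨fun i => c' (T.orderEmbOfFin hTm i), fun i => S (T.orderEmbOfFin hTm i),
    T.orderEmbOfFin hTm, fun i => hc' _, fun i => by simp [hS], fun l => ?_, ?_⟩
  · rw [hsum fun k => ∑ j ∈ S k, A l j, ← hA]
    simpa using congrFun hM l
  · rw [hsum fun k => prefixWeight w (k + 1), ← hcost]
    exact hcost'

theorem exists_portfolio {d r m : ℕ} (hm : m = min d r) (hm0 : 0 < m) {A : Fin r → Fin d → ℝ}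
    {b : Fin r → ℝ} (hA : ∀ i j, 0 ≤ A i j) (hb : ∀ i, 0 ≤ b i) {q β : ℝ} (hβ : 0 ≤ β)
    {V : Finset ℝ} (hV : IsRounding m β V) {D : Finset ℕ}
    (hD : ∀ n, 1 ≤ n → n ≤ d → ∃ k ∈ D, n ≤ k ∧ (k : ℝ) ≤ q * n) {P : Set (Fin d → ℝ)}
    (hP : P = {x | (∀ j, 0 ≤ x j) ∧ ∀ i, b i ≤ ∑ j, A i j * x j}) :
    ∃ X ⊆ P, X.Finite ∧ X.ncard ≤ (#D * #V ^ r) ^ m ∧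
      ∀ w : Fin d → ℝ, IsWeightVector w → ∀ y ∈ P, ∃ x ∈ X,
        orderedNorm w x ≤ β * q * orderedNorm w y := by
  classical
  choose z hz0 hz using fun k t => exists_cheapest_indicator A k t
  set F : (Fin m → D × (Fin r → V)) → Fin d → ℝ := fun κ =>
    β • ∑ i, z (κ i).1 fun l => (κ i).2 l * b l with hF
  have hfin : (Set.range F).Finite := Set.finite_range F
  refine ⟨P ∩ Set.range F, Set.inter_subset_left, hfin.subset Set.inter_subset_right, ?_, ?_⟩
  · calc (P ∩ Set.range F).ncard ≤ (Set.range F).ncard :=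
          Set.ncard_le_ncard Set.inter_subset_right hfin
      _ = #(univ.image F) := by rw [← Set.ncard_coe_finset, coe_image, coe_univ, Set.image_univ]
      _ ≤ _ := by
        refine card_image_le.trans ?_
        simp
  · intro w hw y hy
    rw [hP] at hy
    obtain ⟨c, S, k, hc, hS, hcA, hcost⟩ := exists_few_indicators hm A hw hy.1
    choose v hvV hv using fun l => hV.exists_scaled hm0 (hb l)
      (fun i => mul_nonneg (hc i) (sum_nonneg fun j (_ : j ∈ S i) => hA l j))
      ((hy.2 l).trans_eq (hcA l).symm)
    choose n hnD hn hnq using fun i => hD (k i + 1) (Nat.succ_pos _) (k i).2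
    set κ : Fin m → D × (Fin r → V) := fun i => (⟨n i, hnD i⟩, fun l => ⟨v l i, (hvV l i).1⟩)
    have hzi := fun i => hz (n i) (fun l => v l i * b l) (S i) (c i) ((hS i).trans_le (hn i)) (hc i)
      fun l => (hvV l i).2
    have hFκ : F κ = β • ∑ i, z (n i) fun l => v l i * b l := rfl
    refine ⟨F κ, ⟨?_, κ, rfl⟩, ?_⟩
    · rw [hP, hFκ]
      refine ⟨fun j => ?_, fun l => (hv l).trans ?_⟩
      · rw [Pi.smul_apply, Finset.sum_apply]
        exact mul_nonneg hβ (sum_nonneg fun i _ => hz0 _ _ _)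
      · simp only [Pi.smul_apply, Finset.sum_apply, smul_eq_mul, mul_left_comm _ β, ← mul_sum]
        refine mul_le_mul_of_nonneg_left ?_ hβ
        simp only [mul_sum]
        rw [sum_comm]
        exact sum_le_sum fun i _ => (hzi i).1 l
    · rw [hFκ]
      refine (orderedNorm_smul_le hw hβ _).trans ?_
      rw [mul_assoc]
      refine mul_le_mul_of_nonneg_left ?_ hβ
      refine (orderedNorm_sum_le hw _ _).trans ?_
      have hq : 0 ≤ q := by
        have h1 := (Nat.cast_nonneg (α := ℝ) _).trans (hnq ⟨0, hm0⟩)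
        exact nonneg_of_mul_nonneg_left h1 (by positivity)
      calc _ ≤ ∑ i, c i * prefixWeight w (n i) := sum_le_sum fun i _ => (hzi i).2 w hw
        _ ≤ ∑ i, q * (c i * prefixWeight w (k i + 1)) := by
          refine sum_le_sum fun i _ => ?_
          rw [mul_left_comm]
          refine mul_le_mul_of_nonneg_left ?_ (hc i)
          have hk : (0 : ℝ) < ((k i + 1 : ℕ) : ℝ) := by positivity
          have h1 := mul_prefixWeight_le hw.1 hw.2.1 (hn i)
          have h2 := mul_le_mul_of_nonneg_right (hnq i)
            (prefixWeight_pos hw (Nat.succ_pos (k i))).le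
          refine le_of_mul_le_mul_left (h1.trans (h2.trans_eq ?_)) hk
          ring
        _ ≤ q * orderedNorm w y := by
          rw [← mul_sum]
          exact mul_le_mul_of_nonneg_left hcost hq

theorem card_bound {a v r m N : ℕ} (hr : 2 ≤ r) (hm : m ≤ r) (ha : a ≤ N) (hv : v ≤ N)
    (hN : 1 ≤ N) : (a * v ^ r) ^ m ≤ N ^ (3 * r ^ 2 - 2 * r) := by
  calc (a * v ^ r) ^ m ≤ (N * N ^ r) ^ m := by gcongr
    _ = N ^ ((r + 1) * m) := by rw [← pow_succ', ← pow_mul]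
    _ ≤ N ^ (3 * r ^ 2 - 2 * r) := by
      refine Nat.pow_le_pow_right hN (Nat.le_sub_of_add_le ?_)
      nlinarith

theorem level_count_le {d : ℕ} (hd : 2 ≤ d) {ε : ℝ} (hε : 0 < ε) (hε1 : ε ≤ 1) :
    ∃ K : ℕ, d / (ε / 8) ≤ (1 + ε / 8) ^ K ∧
      ((K + 2 : ℕ) : ℝ) ≤ 100 * Real.log (d / ε) / ε := by
  have hd' : (2 : ℝ) ≤ d := by exact_mod_cast hd
  have hlog2 := Real.log_two_gt_d9
  have hdε : 2 ≤ d / ε := by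
    rw [le_div_iff₀ hε]
    nlinarith
  have hL : Real.log 2 ≤ Real.log (d / ε) := Real.log_le_log (by norm_num) hdε
  have hlogq : ε / 16 ≤ Real.log (1 + ε / 8) := by
    refine le_trans ?_ (Real.one_sub_inv_le_log_of_pos (by positivity))
    rw [le_sub_iff_add_le, ← le_sub_iff_add_le', inv_le_iff_one_le_mul₀ (by positivity)]
    nlinarith
  have hq0 : 0 < Real.log (1 + ε / 8) := by linarith [div_pos hε (by norm_num : (0 : ℝ) < 16)]
  have hlog8 : Real.log (d / (ε / 8)) = 3 * Real.log 2 + Real.log (d / ε) := by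
    rw [show (d : ℝ) / (ε / 8) = 2 ^ 3 * (d / ε) by field_simp; norm_num,
      Real.log_mul (by norm_num) (by positivity), Real.log_pow]
    norm_num
  set L := Real.log (d / ε) with hLdef
  refine ⟨⌈Real.log (d / (ε / 8)) / Real.log (1 + ε / 8)⌉₊, ?_, ?_⟩
  · rw [← Real.log_le_log_iff (by positivity) (by positivity), Real.log_pow, ← div_le_iff₀ hq0]
    exact Nat.le_ceil _
  · have hceil := Nat.ceil_lt_add_one (a := Real.log (d / (ε / 8)) / Real.log (1 + ε / 8))
      (div_nonneg (by rw [hlog8]; linarith) hq0.le)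
    have hdiv : Real.log (d / (ε / 8)) / Real.log (1 + ε / 8) ≤ 4 * L / (ε / 16) := by
      gcongr
      · linarith
      · linarith
    have h3 : 3 ≤ 6 * L / ε := by
      rw [le_div_iff₀ hε]
      nlinarith
    have h4 : 4 * L / (ε / 16) = 64 * L / ε := by
      field_simp
      ring
    have h5 : 64 * L / ε + 6 * L / ε ≤ 100 * L / ε := by
      rw [← add_div]
      gcongr
      linarith
    push_cast
    linarith

/-- Ordered norms of covering polyhedra have small portfolios. -/
theorem exists_orderedNorm_portfolio {d r : ℕ} (hd : 2 ≤ d) (hr : 1 ≤ r) {ε : ℝ} (hε : 0 < ε)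
    (hε1 : ε ≤ 1) {A : Fin r → Fin d → ℝ} {b : Fin r → ℝ} (hA : ∀ i j, 0 ≤ A i j)
    (hb : ∀ i, 0 ≤ b i) {P : Set (Fin d → ℝ)}
    (hP : P = {x | (∀ j, 0 ≤ x j) ∧ ∀ i, b i ≤ ∑ j, A i j * x j}) :
    ∃ X ⊆ P, X.Finite ∧
      (X.ncard : ℝ) ≤ (100 * Real.log (d / ε) / ε) ^ (3 * r ^ 2 - 2 * r) ∧
      ∀ w : Fin d → ℝ, IsWeightVector w → ∀ y ∈ P, ∃ x ∈ X,
        orderedNorm w x ≤ (1 + ε) * orderedNorm w y := by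
  obtain ⟨K, hK, hcount⟩ := level_count_le hd hε hε1
  set δ := ε / 8 with hδ
  have hδ0 : 0 < δ := by positivity
  have hδ1 : δ ≤ 1 / 8 := by linarith
  have hβ : 1 ≤ (1 + δ) / (1 - δ) := by
    rw [one_le_div (by linarith)]
    linarith
  have hβδ : (1 + δ) / (1 - δ) * (1 - δ) = 1 + δ := div_mul_cancel₀ _ (by linarith)
  have hβq : (1 + δ) / (1 - δ) * (1 + δ) ≤ 1 + ε := by
    rw [div_mul_eq_mul_div, div_le_iff₀ (by linarith)]
    nlinarith
  set D := (range (K + 1)).image fun j => ⌊(1 + δ) ^ j⌋₊ with hDdef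
  have hDcard : #D ≤ K + 1 := card_image_le.trans (by simp)
  have hD : ∀ n, 1 ≤ n → n ≤ d → ∃ k ∈ D, n ≤ k ∧ (k : ℝ) ≤ (1 + δ) * n := by
    refine fun n hn hnd => exists_size_level (by linarith) hn (le_trans ?_ hK)
    rw [le_div_iff₀ hδ0]
    have : (n : ℝ) ≤ d := by exact_mod_cast hnd
    nlinarith [Nat.cast_nonneg (α := ℝ) n]
  suffices h : ∃ V, IsRounding (min d r) ((1 + δ) / (1 - δ)) V ∧
      (#D * #V ^ r) ^ min d r ≤ (K + 2) ^ (3 * r ^ 2 - 2 * r) by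
    obtain ⟨V, hV, hVcard⟩ := h
    obtain ⟨X, hXP, hXfin, hXcard, hX⟩ :=
      exists_portfolio rfl (by omega) hA hb (by linarith) hV hD hP
    refine ⟨X, hXP, hXfin, ?_, fun w hw y hy => ?_⟩
    · calc (X.ncard : ℝ) ≤ (((K + 2) ^ (3 * r ^ 2 - 2 * r) : ℕ) : ℝ) := by
            exact_mod_cast hXcard.trans hVcard
        _ ≤ _ := by
          rw [Nat.cast_pow]
          gcongr
    · obtain ⟨x, hx, hxy⟩ := hX w hw y hy
      refine ⟨x, hx, hxy.trans (mul_le_mul_of_nonneg_right hβq ?_)⟩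
      exact sum_nonneg fun k _ => mul_nonneg (hw.2.1 k) (abs_nonneg _)
  rcases hr.eq_or_lt with rfl | hr
  · have hmin : min d 1 = 1 := by omega
    rw [hmin]
    refine ⟨{1}, isRounding_singleton hβ, ?_⟩
    simp
    omega
  · refine ⟨_, isRounding_geometric hδ0 (by linarith) (by omega) (min_le_left d r) hK hβ hβδ.ge,
      card_bound hr (min_le_right d r) (hDcard.trans (by omega)) ?_ (by omega)⟩
    refine (card_insert_le _ _).trans (Nat.succ_le_succ (card_image_le.trans ?_))
    simp

/-- The value of a norm at the indicator of the first `k` coordinates. -/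
def prefixNorm {d : ℕ} (f : (Fin d → ℝ) → ℝ) (k : ℕ) : ℝ :=
  f fun i => if (i : ℕ) < k then 1 else 0

namespace IsSymMonotoneNorm

variable {ι : Type*} [Fintype ι] {f : (ι → ℝ) → ℝ}

theorem map_zero (hf : IsSymMonotoneNorm f) : f 0 = 0 := (hf.1 0).2 rfl

theorem map_sum_le {κ : Type*} (hf : IsSymMonotoneNorm f) (s : Finset κ) (x : κ → ι → ℝ) :
    f (∑ i ∈ s, x i) ≤ ∑ i ∈ s, f (x i) :=
  le_sum_of_subadditive f hf.map_zero.le hf.2.2.1 s x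

theorem map_nonneg (hf : IsSymMonotoneNorm f) {x : ι → ℝ} (hx : ∀ i, 0 ≤ x i) : 0 ≤ f x :=
  hf.map_zero.symm.trans_le (hf.2.2.2.2 0 x (fun _ => le_rfl) hx)

end IsSymMonotoneNorm

section

variable {d : ℕ} {f : (Fin d → ℝ) → ℝ}

theorem prefixNorm_nonneg (hf : IsSymMonotoneNorm f) (k : ℕ) : 0 ≤ prefixNorm f k :=
  hf.map_nonneg fun i => by split_ifs <;> norm_num

theorem mul_prefixNorm_succ_le (hf : IsSymMonotoneNorm f) {k : ℕ} (hk : k < d) :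
    k * prefixNorm f (k + 1) ≤ (k + 1) * prefixNorm f k := by
  set e : Fin d → ℝ := fun i => if (i : ℕ) < k then 1 else 0 with he
  set T : Finset (Fin d) := Iic ⟨k, hk⟩ with hT
  have hTcard : #T = k + 1 := by simp [hT]
  have hsum : (k : ℝ) • (fun i : Fin d => if (i : ℕ) < k + 1 then (1 : ℝ) else 0)
      = ∑ a ∈ T, e ∘ Equiv.swap a ⟨k, hk⟩ := by
    have hterm : ∀ a ∈ T, ∀ i, e (Equiv.swap a ⟨k, hk⟩ i)
        = (if i ∈ T then 1 else 0) - if i = a then 1 else 0 := by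
      intro a ha i
      rw [hT, mem_Iic, Fin.le_def] at ha
      simp only [he, hT, mem_Iic, Fin.le_def]
      by_cases hia : i = a
      · subst hia
        simp [ha]
      · by_cases hik : i = ⟨k, hk⟩
        · subst hik
          have : (a : ℕ) < k := lt_of_le_of_ne ha fun h => hia (Fin.ext h.symm)
          simp [this, hia]
        · have : (i : ℕ) ≠ k := fun h => hik (Fin.ext h)
          rw [Equiv.swap_apply_of_ne_of_ne hia hik, if_neg hia, sub_zero]
          exact if_congr (by omega) rfl rfl
    ext i
    rw [Finset.sum_apply]
    simp only [Function.comp_apply]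
    rw [sum_congr rfl fun a ha => hterm a ha i, sum_sub_distrib, sum_const, hTcard, sum_ite_eq]
    by_cases hi : (i : ℕ) < k + 1
    · have : i ∈ T := mem_Iic.2 (Fin.le_def.2 (Nat.lt_succ_iff.1 hi))
      rw [if_pos this, Pi.smul_apply, if_pos hi]
      simp
    · have : i ∉ T := fun h => hi (Nat.lt_succ_iff.2 (Fin.le_def.1 (mem_Iic.1 h)))
      rw [if_neg this, Pi.smul_apply, if_neg hi]
      simp
  calc k * prefixNorm f (k + 1) = f (∑ a ∈ T, e ∘ Equiv.swap a ⟨k, hk⟩) := by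
        rw [← hsum, hf.2.1, abs_of_nonneg (Nat.cast_nonneg k), prefixNorm]
    _ ≤ ∑ a ∈ T, f (e ∘ Equiv.swap a ⟨k, hk⟩) := hf.map_sum_le _ _
    _ = (k + 1) * prefixNorm f k := by
        rw [sum_congr rfl fun a _ => hf.2.2.2.1 (Equiv.swap a ⟨k, hk⟩) e, sum_const, hTcard,
          nsmul_eq_mul, prefixNorm]
        push_cast
        rfl

/-- The weights of the ordered norm approximating `f`. -/
noncomputable def normWeights (f : (Fin d → ℝ) → ℝ) (k : Fin d) : ℝ :=
  prefixNorm f (k + 1) / (k + 1)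

theorem isWeightVector_normWeights (hd : 0 < d) (hf : IsSymMonotoneNorm f) :
    IsWeightVector (normWeights f) := by
  refine ⟨?_, fun k => div_nonneg (prefixNorm_nonneg hf _) (by positivity), fun h => ?_⟩
  · obtain ⟨d, rfl⟩ : ∃ n, d = n + 1 := ⟨d - 1, by omega⟩
    refine Fin.antitone_iff_succ_le.2 fun k => ?_
    have := mul_prefixNorm_succ_le hf (k := k + 1) (by omega)
    simp only [normWeights, Fin.val_succ, Fin.val_castSucc]
    rw [div_le_div_iff₀ (by positivity) (by positivity)]
    push_cast at this ⊢
    linarith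
  · have h0 : prefixNorm f 1 = 0 := by simpa [normWeights] using congrFun h ⟨0, hd⟩
    have := congrFun ((hf.1 _).1 h0) ⟨0, hd⟩
    simp at this

theorem prefixNorm_le_sum_normWeights (hd : 0 < d) (hf : IsSymMonotoneNorm f) (k : Fin d) :
    prefixNorm f (k + 1) ≤ ∑ i ∈ Iic k, normWeights f i := by
  calc prefixNorm f (k + 1) = ∑ i ∈ Iic k, normWeights f k := by
        rw [sum_const, Fin.card_Iic, nsmul_eq_mul, normWeights]
        push_cast
        field_simp
    _ ≤ _ := sum_le_sum fun i hi => (isWeightVector_normWeights hd hf).1 (mem_Iic.1 hi)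

theorem map_absSortDesc (hf : IsSymMonotoneNorm f) {x : Fin d → ℝ} (hx : ∀ i, 0 ≤ x i) :
    f (absSortDesc x) = f x := by
  rw [← hf.2.2.2.1 (descPerm x) x]
  congr 1
  ext k
  rw [absSortDesc_eq, abs_of_nonneg (hx _), Function.comp_apply]

theorem le_orderedNorm_normWeights (hd : 0 < d) (hf : IsSymMonotoneNorm f) {x : Fin d → ℝ}
    (hx : ∀ i, 0 ≤ x i) : f x ≤ orderedNorm (normWeights f) x := by
  obtain ⟨c, hc, hlayer⟩ := exists_layers (absSortDesc_antitone x) fun k => abs_nonneg _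
  have hdecomp : absSortDesc x
      = ∑ k, c k • fun i : Fin d => if (i : ℕ) < k + 1 then (1 : ℝ) else 0 := by
    ext i
    rw [hlayer, Finset.sum_apply]
    refine sum_congr rfl fun k _ => ?_
    simp
  calc f x = f (∑ k, c k • fun i : Fin d => if (i : ℕ) < k + 1 then (1 : ℝ) else 0) := by
        rw [← hdecomp, map_absSortDesc hf hx]
    _ ≤ ∑ k, c k * prefixNorm f (k + 1) := by
        refine (hf.map_sum_le _ _).trans_eq (sum_congr rfl fun k _ => ?_)
        rw [hf.2.1, abs_of_nonneg (hc k), prefixNorm]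
    _ ≤ ∑ k, c k * ∑ i ∈ Iic k, normWeights f i := sum_le_sum fun k _ =>
        mul_le_mul_of_nonneg_left (prefixNorm_le_sum_normWeights hd hf k) (hc k)
    _ = orderedNorm (normWeights f) x := (sum_mul_layers hlayer _).symm

theorem orderedNorm_normWeights_le (hf : IsSymMonotoneNorm f) {x : Fin d → ℝ}
    (hx : ∀ i, 0 ≤ x i) : orderedNorm (normWeights f) x ≤ (1 + Real.log d) * f x := by
  have hterm : ∀ k : Fin d,
      normWeights f k * absSortDesc x k ≤ ((((k : ℕ) + 1 : ℕ) : ℝ))⁻¹ * f x := by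
    intro k
    have h0 : 0 ≤ absSortDesc x k := abs_nonneg _
    have hle : absSortDesc x k * prefixNorm f (k + 1) ≤ f x := by
      rw [← map_absSortDesc hf hx, prefixNorm, ← abs_of_nonneg h0, ← hf.2.1]
      refine hf.2.2.2.2 _ _ (fun i => ?_) fun i => ?_
      · exact mul_nonneg h0 (by dsimp only; split_ifs <;> norm_num)
      · simp only [Pi.smul_apply, smul_eq_mul]
        split_ifs with hi
        · rw [mul_one]
          exact absSortDesc_antitone x (Fin.le_def.2 (Nat.lt_succ_iff.1 hi))
        · rw [mul_zero]
          exact abs_nonneg _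
    rw [normWeights, div_mul_eq_mul_div, div_eq_inv_mul, mul_comm (prefixNorm f _)]
    push_cast
    gcongr
  calc orderedNorm (normWeights f) x ≤ ∑ k : Fin d, ((((k : ℕ) + 1 : ℕ) : ℝ))⁻¹ * f x :=
        sum_le_sum fun k _ => hterm k
    _ = (harmonic d : ℝ) * f x := by
        rw [← sum_mul, harmonic, ← sum_range fun k : ℕ => (((k + 1 : ℕ) : ℝ))⁻¹]
        push_cast
        rfl
    _ ≤ _ := mul_le_mul_of_nonneg_right (harmonic_le_one_add_log d) (hf.map_nonneg hx)

end

/-- Theorem 2: portfolios for covering polyhedra. -/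
theorem stmt2 :
    ∃ C C' : ℝ, 0 < C ∧ 0 < C' ∧
      ∀ d r : ℕ, 2 ≤ d → 1 ≤ r →
      ∀ ε : ℝ, 0 < ε → ε ≤ 1 →
      ∀ (A : Fin r → Fin d → ℝ) (b : Fin r → ℝ),
        (∀ i j, 0 ≤ A i j) → (∀ i, 0 ≤ b i) →
        ∀ P : Set (Fin d → ℝ),
          P = {x | (∀ j, 0 ≤ x j) ∧ ∀ i, b i ≤ ∑ j, A i j * x j} →
          P.Nonempty →
          ∃ X : Set (Fin d → ℝ), X ⊆ P ∧ X.Finite ∧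
            (X.ncard : ℝ) ≤ (C * Real.log ((d : ℝ) / ε) / ε) ^ (3 * r ^ 2 - 2 * r) ∧
            (∀ w : Fin d → ℝ, IsWeightVector w →
              ∀ y ∈ P, ∃ x ∈ X, orderedNorm w x ≤ (1 + ε) * orderedNorm w y) ∧
            (∀ f : (Fin d → ℝ) → ℝ, IsSymMonotoneNorm f →
              ∀ y ∈ P, ∃ x ∈ X, f x ≤ C' * Real.log d * f y) := by
  refine ⟨100, 6, by norm_num, by norm_num, fun d r hd hr ε hε hε1 A b hA hb P hP _ => ?_⟩
  obtain ⟨X, hXP, hXfin, hXcard, hX⟩ := exists_orderedNorm_portfolio hd hr hε hε1 hA hb hP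
  refine ⟨X, hXP, hXfin, hXcard, hX, fun f hf y hy => ?_⟩
  obtain ⟨x, hx, hxy⟩ := hX _ (isWeightVector_normWeights (by omega) hf) y hy
  have hnonneg : ∀ z ∈ P, ∀ j, 0 ≤ z j := by
    intro z hz
    rw [hP] at hz
    exact hz.1
  have hlog : Real.log 2 ≤ Real.log d :=
    Real.log_le_log (by norm_num) (by exact_mod_cast hd)
  have hlog2 := Real.log_two_gt_d9
  refine ⟨x, hx, ?_⟩
  calc f x ≤ orderedNorm (normWeights f) x :=
        le_orderedNorm_normWeights (by omega) hf (hnonneg x (hXP hx))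
    _ ≤ (1 + ε) * orderedNorm (normWeights f) y := hxy
    _ ≤ (1 + ε) * ((1 + Real.log d) * f y) := mul_le_mul_of_nonneg_left
        (orderedNorm_normWeights_le hf (hnonneg y hy)) (by linarith)
    _ = ((1 + ε) * (1 + Real.log d)) * f y := by ring
    _ ≤ 6 * Real.log d * f y := by
        refine mul_le_mul_of_nonneg_right ?_ (hf.map_nonneg (hnonneg y hy))
        nlinarith
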